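/- Fix 0 < s ≤ 1 and 0 < α < s. For each n let X_n be an ⌊n^s⌋ × n random matrix with i.i.d. standard Gaussian entries, set A_n = X_n X_nᵀ / n, and let B_n be the entrywise matrix |A_n(i,j)|^α. Then P(λ_min(B_n) < 0) → 1 as n → ∞. -/

import Mathlib

open MeasureTheory ProbabilityTheory Filter Finset

section RealMoments

lemma integrable_abs_rpow_gaussianReal {β : ℝ} (hβ : 0 ≤ β) :
    Integrable (fun t : ℝ => |t| ^ β) (gaussianReal 0 1) := by
  lift β to NNReal using hβ
  simpa using (memLp_id_gaussianReal (μ := 0) (v := 1) β).integrable_norm_rpow'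

lemma integrable_pow_gaussianReal (k : ℕ) :
    Integrable (fun t : ℝ => t ^ k) (gaussianReal 0 1) := by
  rw [← integrable_norm_iff (by fun_prop)]
  simpa using integrable_abs_rpow_gaussianReal (Nat.cast_nonneg k)

lemma integral_sq_gaussianReal : ∫ t : ℝ, t ^ 2 ∂(gaussianReal 0 1) = 1 := by
  have h := variance_fun_id_gaussianReal (μ := 0) (v := 1)
  rw [variance_of_integral_eq_zero (by fun_prop) (by simp)] at h
  simpa using h

lemma sq_mul_abs_rpow {β : ℝ} (hβ : 0 < β) (t : ℝ) : t ^ 2 * |t| ^ β = |t| ^ (2 + β) := by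
  rcases eq_or_ne t 0 with rfl | ht
  · simp [Real.zero_rpow hβ.ne', Real.zero_rpow (by linarith : 2 + β ≠ 0)]
  · rw [Real.rpow_add (abs_pos.2 ht)]
    simp

lemma integrable_sq_mul_abs_rpow_gaussianReal {β : ℝ} (hβ : 0 < β) :
    Integrable (fun t : ℝ => t ^ 2 * |t| ^ β) (gaussianReal 0 1) := by
  simp_rw [sq_mul_abs_rpow hβ]
  exact integrable_abs_rpow_gaussianReal (by linarith)

/-- The degree two Hermite coefficient of `t ↦ |t| ^ β`. -/
noncomputable def hermiteCoeff (β : ℝ) : ℝ :=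
  ∫ t : ℝ, (t ^ 2 - 1) * |t| ^ β ∂(gaussianReal 0 1)

lemma integrable_hermiteCoeff {β : ℝ} (hβ : 0 < β) :
    Integrable (fun t : ℝ => (t ^ 2 - 1) * |t| ^ β) (gaussianReal 0 1) := by
  simp_rw [sub_mul, one_mul]
  exact (integrable_sq_mul_abs_rpow_gaussianReal hβ).sub (integrable_abs_rpow_gaussianReal hβ.le)

lemma hermiteCoeff_pos {β : ℝ} (hβ : 0 < β) : 0 < hermiteCoeff β := by
  have h0 : ∫ t : ℝ, (t ^ 2 - 1) ∂(gaussianReal 0 1) = 0 := by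
    rw [integral_sub (integrable_pow_gaussianReal 2) (integrable_const _),
      integral_sq_gaussianReal]
    simp
  have hi : Integrable (fun t : ℝ => t ^ 2 - 1) (gaussianReal 0 1) :=
    (integrable_pow_gaussianReal 2).sub (integrable_const _)
  have h1 : hermiteCoeff β = ∫ t : ℝ, (t ^ 2 - 1) * (|t| ^ β - 1) ∂(gaussianReal 0 1) := by
    rw [hermiteCoeff]
    simp_rw [mul_sub, mul_one]
    rw [integral_sub (integrable_hermiteCoeff hβ) hi, h0, sub_zero]
  have hpos : ∀ t : ℝ, |t| ≠ 1 → 0 < (t ^ 2 - 1) * (|t| ^ β - 1) := by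
    intro t ht
    rcases lt_or_gt_of_ne ht with h | h
    · exact mul_pos_of_neg_of_neg (by nlinarith [sq_abs t, abs_nonneg t])
        (by linarith [Real.rpow_lt_one (abs_nonneg t) h hβ])
    · exact mul_pos (by nlinarith [sq_abs t, abs_nonneg t])
        (by linarith [Real.one_lt_rpow h hβ])
  rw [h1, integral_pos_iff_support_of_nonneg]
  · have : ({1, -1} : Set ℝ)ᶜ ⊆ Function.support fun t : ℝ => (t ^ 2 - 1) * (|t| ^ β - 1) := by
      intro t ht
      refine (hpos t fun h => ht ?_).ne'
      rcases abs_eq (zero_le_one) |>.1 h with h | h <;> simp [h]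
    refine lt_of_lt_of_le ?_ (measure_mono this)
    have := nullSingletonClass_gaussianReal (μ := 0) (v := 1) one_ne_zero
    rw [prob_compl_eq_one_sub (by measurability), (Set.toFinite _).measure_zero]
    simp
  · intro t
    by_cases ht : |t| = 1
    · simp [ht]
    · exact (hpos t ht).le
  · simp_rw [mul_sub, mul_one]
    exact (integrable_hermiteCoeff hβ).sub hi

lemma integrable_sq_hermiteCoeff {β : ℝ} (hβ : 0 < β) :
    Integrable (fun t : ℝ => ((t ^ 2 - 1) * |t| ^ β) ^ 2) (gaussianReal 0 1) := by
  have h : ∀ t : ℝ, ((t ^ 2 - 1) * |t| ^ β) ^ 2 =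
      |t| ^ (2 * (2 + β)) - 2 * |t| ^ (2 + 2 * β) + |t| ^ (2 * β) := by
    intro t
    rw [sub_mul, sq_mul_abs_rpow hβ, mul_comm 2 (2 + β), Real.rpow_mul (abs_nonneg t),
      ← sq_mul_abs_rpow (by positivity : 0 < 2 * β), mul_comm 2 β, Real.rpow_mul (abs_nonneg t),
      ← sq_mul_abs_rpow hβ]
    simp only [Real.rpow_two]
    ring
  simp_rw [h]
  exact ((integrable_abs_rpow_gaussianReal (by positivity)).sub
    ((integrable_abs_rpow_gaussianReal (by positivity)).const_mul 2)).add
    (integrable_abs_rpow_gaussianReal (by positivity))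

lemma integrable_hermite_pow_four :
    Integrable (fun t : ℝ => (t ^ 2 - 1) ^ 4) (gaussianReal 0 1) := by
  have h : ∀ t : ℝ, (t ^ 2 - 1) ^ 4 = t ^ 8 - 4 * t ^ 6 + 6 * t ^ 4 - 4 * t ^ 2 + 1 := by
    intro t; ring
  simp_rw [h]
  exact ((((integrable_pow_gaussianReal 8).sub ((integrable_pow_gaussianReal 6).const_mul 4)).add
    ((integrable_pow_gaussianReal 4).const_mul 6)).sub
    ((integrable_pow_gaussianReal 2).const_mul 4)).add (integrable_const _)

end RealMoments

section StdGaussian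

variable {E : Type*} [NormedAddCommGroup E] [InnerProductSpace ℝ E] [FiniteDimensional ℝ E]
  [MeasurableSpace E] [BorelSpace E]

lemma map_inner_stdGaussian {u : E} (hu : ‖u‖ = 1) :
    (stdGaussian E).map (fun x => inner ℝ u x) = gaussianReal 0 1 := by
  have h := IsGaussian.map_eq_gaussianReal (μ := stdGaussian E) (innerSL ℝ u)
  rw [integral_strongDual_stdGaussian, variance_dual_stdGaussian, innerSL_apply_norm, hu] at h
  simpa using h

lemma integrable_inner_stdGaussian {u : E} (hu : ‖u‖ = 1) {f : ℝ → ℝ}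
    (hf : Integrable f (gaussianReal 0 1)) :
    Integrable (fun x => f (inner ℝ u x)) (stdGaussian E) := by
  rw [← map_inner_stdGaussian hu] at hf
  exact hf.comp_aemeasurable (by fun_prop)

lemma integral_inner_stdGaussian {u : E} (hu : ‖u‖ = 1) {f : ℝ → ℝ}
    (hf : Integrable f (gaussianReal 0 1)) :
    ∫ x, f (inner ℝ u x) ∂(stdGaussian E) = ∫ t, f t ∂(gaussianReal 0 1) := by
  rw [← map_inner_stdGaussian hu] at hf ⊢
  rw [integral_map (by fun_prop) hf.aestronglyMeasurable]

lemma integral_inner_sq_stdGaussian (v : E) :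
    ∫ x, (inner ℝ v x) ^ 2 ∂(stdGaussian E) = ‖v‖ ^ 2 := by
  have h := variance_dual_stdGaussian (innerSL ℝ v)
  rw [variance_of_integral_eq_zero (by fun_prop) (integral_strongDual_stdGaussian _),
    innerSL_apply_norm] at h
  simpa using h

lemma indepFun_inner_stdGaussian {u v : E} (huv : inner ℝ u v = 0) :
    IndepFun (fun x => inner ℝ u x) (fun x => inner ℝ v x) (stdGaussian E) := by
  refine HasGaussianLaw.indepFun_of_covariance_eq_zero ?_ ?_
  · exact (IsGaussian.hasGaussianLaw_id (μ := stdGaussian E)).map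
      ((innerSL ℝ u).prod (innerSL ℝ v))
  · rw [← huv, ← innerSL_apply_apply ℝ u v, ← covarianceBilin_stdGaussian,
      covarianceBilin_apply_eq_cov IsGaussian.memLp_two_id]

lemma integral_hermite_mul_abs_rpow {β : ℝ} (hβ : 0 < β) {u e : E} (hu : ‖u‖ = 1)
    (he : ‖e‖ = 1) :
    ∫ x, ((inner ℝ u x) ^ 2 - 1) * |inner ℝ e x| ^ β ∂(stdGaussian E) =
      hermiteCoeff β * (inner ℝ u e) ^ 2 := by
  set c : ℝ := inner ℝ u e with hc
  set v : E := u - c • e with hv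
  have hev : inner ℝ e v = 0 := by
    rw [hv, inner_sub_right, inner_smul_right, real_inner_self_eq_norm_sq, he, hc,
      real_inner_comm]
    ring
  have hvn : ‖v‖ ^ 2 = 1 - c ^ 2 := by
    rw [hv, norm_sub_sq_real, inner_smul_right, norm_smul, hu, he, ← hc, mul_one,
      Real.norm_eq_abs, sq_abs]
    ring
  have hdec : ∀ x : E, inner ℝ u x = c * inner ℝ e x + inner ℝ v x := by
    intro x
    rw [hv, inner_sub_left, inner_smul_left]
    simp
  have hind := indepFun_inner_stdGaussian hev
  have hr : Integrable (fun x => |inner ℝ e x| ^ β) (stdGaussian E) :=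
    integrable_inner_stdGaussian he (integrable_abs_rpow_gaussianReal hβ.le)
  have hsr : Integrable (fun x => (inner ℝ e x) ^ 2 * |inner ℝ e x| ^ β) (stdGaussian E) :=
    integrable_inner_stdGaussian he (integrable_sq_mul_abs_rpow_gaussianReal hβ)
  have hor : Integrable (fun x => inner ℝ e x * |inner ℝ e x| ^ β) (stdGaussian E) := by
    refine (hr.add hsr).mono' (by fun_prop) (ae_of_all _ fun x => ?_)
    have h0 : 0 ≤ |inner ℝ e x| ^ β := by positivity
    simp only [norm_mul, Real.norm_eq_abs, abs_of_nonneg h0, Pi.add_apply]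
    have h1 : |inner ℝ e x| ≤ 1 + (inner ℝ e x) ^ 2 := by
      nlinarith [sq_abs (inner ℝ e x), sq_nonneg (|inner ℝ e x| - 1)]
    nlinarith
  have hv1 : Integrable (fun x => inner ℝ v x) (stdGaussian E) :=
    IsGaussian.integrable_dual _ (innerSL ℝ v)
  have hv2 : Integrable (fun x => (inner ℝ v x) ^ 2) (stdGaussian E) :=
    (IsGaussian.memLp_dual _ (innerSL ℝ v) 2 (by simp)).integrable_sq
  have hind1 : IndepFun (fun x => inner ℝ e x * |inner ℝ e x| ^ β) (fun x => inner ℝ v x)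
      (stdGaussian E) :=
    hind.comp (φ := fun t : ℝ => t * |t| ^ β) (ψ := id) (by fun_prop) measurable_id
  have hind2 : IndepFun (fun x => |inner ℝ e x| ^ β) (fun x => (inner ℝ v x) ^ 2)
      (stdGaussian E) :=
    hind.comp (φ := fun t : ℝ => |t| ^ β) (ψ := fun t => t ^ 2) (by fun_prop) (by fun_prop)
  have hi1 : Integrable (fun x => inner ℝ e x * |inner ℝ e x| ^ β * inner ℝ v x)
    (stdGaussian E) := hind1.integrable_mul hor hv1
  have hi2 : Integrable (fun x => |inner ℝ e x| ^ β * (inner ℝ v x) ^ 2)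
    (stdGaussian E) := hind2.integrable_mul hr hv2
  have he1 : ∫ x, inner ℝ e x * |inner ℝ e x| ^ β * inner ℝ v x ∂(stdGaussian E) = 0 := by
    rw [hind1.integral_fun_mul_eq_mul_integral hor.aestronglyMeasurable hv1.aestronglyMeasurable]
    have : ∫ x, inner ℝ v x ∂(stdGaussian E) = 0 :=
      integral_strongDual_stdGaussian (innerSL ℝ v)
    rw [this, mul_zero]
  have he2 : ∫ x, |inner ℝ e x| ^ β * (inner ℝ v x) ^ 2 ∂(stdGaussian E) =
      (∫ x, |inner ℝ e x| ^ β ∂(stdGaussian E)) * (1 - c ^ 2) := by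
    rw [hind2.integral_fun_mul_eq_mul_integral hr.aestronglyMeasurable hv2.aestronglyMeasurable,
      integral_inner_sq_stdGaussian, hvn]
  have hk : hermiteCoeff β = (∫ x, (inner ℝ e x) ^ 2 * |inner ℝ e x| ^ β ∂(stdGaussian E)) -
      ∫ x, |inner ℝ e x| ^ β ∂(stdGaussian E) := by
    rw [hermiteCoeff, ← integral_inner_stdGaussian he (integrable_hermiteCoeff hβ),
      ← integral_sub hsr hr]
    simp_rw [sub_mul, one_mul]
  have hexp : ∀ x : E, ((inner ℝ u x) ^ 2 - 1) * |inner ℝ e x| ^ β =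
      c ^ 2 * ((inner ℝ e x) ^ 2 * |inner ℝ e x| ^ β) +
      2 * c * (inner ℝ e x * |inner ℝ e x| ^ β * inner ℝ v x) +
      |inner ℝ e x| ^ β * (inner ℝ v x) ^ 2 - |inner ℝ e x| ^ β := by
    intro x
    rw [hdec x]
    ring
  simp_rw [hexp]
  rw [integral_sub (((hsr.const_mul _).fun_add (hi1.const_mul _)).fun_add hi2) hr,
    integral_add ((hsr.const_mul _).fun_add (hi1.const_mul _)) hi2,
    integral_add (hsr.const_mul _) (hi1.const_mul _), integral_const_mul, integral_const_mul,
    he1, he2, hk]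
  ring

lemma integral_hermite_mul_abs_inner_rpow {β : ℝ} (hβ : 0 < β) {u : E} (hu : ‖u‖ = 1) (y : E) :
    ∫ x, ((inner ℝ u x) ^ 2 - 1) * |inner ℝ x y| ^ β ∂(stdGaussian E) =
      hermiteCoeff β * (‖y‖ ^ (β - 2) * (inner ℝ u y) ^ 2) := by
  rcases eq_or_ne y 0 with rfl | hy
  · simp [Real.zero_rpow hβ.ne']
  have hy0 : 0 < ‖y‖ := norm_pos_iff.2 hy
  have h := integral_hermite_mul_abs_rpow hβ hu (norm_smul_inv_norm (𝕜 := ℝ) hy)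
  have h1 : ∀ x : E, |inner ℝ x y| ^ β = ‖y‖ ^ β * |inner ℝ (((‖y‖ : ℝ)⁻¹) • y) x| ^ β := by
    intro x
    rw [← Real.mul_rpow hy0.le (abs_nonneg _), inner_smul_left, abs_mul]
    simp [real_inner_comm, hy0.ne']
  simp_rw [h1, mul_left_comm _ (‖y‖ ^ β)]
  rw [integral_const_mul]
  simp only [RCLike.ofReal_real_eq_id, id_eq] at h
  rw [h, inner_smul_right, Real.rpow_sub hy0, Real.rpow_two]
  field_simp

end StdGaussian

section PointwiseBounds

lemma abs_inner_sq_div_norm_sq_le {E : Type*} [NormedAddCommGroup E]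
    [InnerProductSpace ℝ E] {u : E} (hu : ‖u‖ = 1) (x : E) :
    (inner ℝ u x) ^ 2 / ‖x‖ ^ 2 ≤ 1 := by
  have h := abs_real_inner_le_norm u x
  rw [hu, one_mul] at h
  refine div_le_one_of_le₀ ?_ (by positivity)
  rw [← sq_abs]
  gcongr

lemma hermite_sq_mul_rpow_le (a b β : ℝ) :
    (a ^ 2 - 1) ^ 2 * |b| ^ β ≤ (a ^ 2 - 1) ^ 4 + |b| ^ (2 * β) := by
  rw [mul_comm 2 β, Real.rpow_mul (abs_nonneg b), Real.rpow_two]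
  nlinarith [sq_nonneg ((a ^ 2 - 1) ^ 2 - |b| ^ β), sq_nonneg ((a ^ 2 - 1) ^ 2 + |b| ^ β)]

lemma rpow_two_mul_le {α : ℝ} (hα0 : 0 < α) (hα1 : α ≤ 1) {n : ℝ} (hn : 0 < n)
    (r : ℝ) (hr : 0 ≤ r) :
    r ^ (2 * α) ≤ n ^ α * (1 + r ^ 2 / n) := by
  have h : r ^ (2 * α) = n ^ α * (r ^ 2 / n) ^ α := by
    rw [← Real.mul_rpow hn.le (by positivity), mul_div_cancel₀ _ hn.ne', Real.rpow_mul hr,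
      Real.rpow_two]
  rw [h]
  gcongr
  have ht : 0 ≤ r ^ 2 / n := by positivity
  rcases le_total (r ^ 2 / n) 1 with h1 | h1
  · linarith [Real.rpow_le_one ht h1 hα0.le]
  · have := Real.rpow_le_rpow_of_exponent_le h1 hα1
    rw [Real.rpow_one] at this
    linarith

lemma hermite_mul_rpow_le {α : ℝ} (hα1 : α ≤ 1) {δ : ℝ} (hδ : 0 < δ)
    {E : Type*} [NormedAddCommGroup E] [InnerProductSpace ℝ E] {u : E} (hu : ‖u‖ = 1) (y : E) :
    ((inner ℝ u y) ^ 2 - 1) * (‖y‖ ^ (α - 2) * (inner ℝ u y) ^ 2) ≤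
      δ * |inner ℝ u y| ^ (4 + 2 * α) + δ⁻¹ * ((inner ℝ u y) ^ 2 / ‖y‖ ^ 2) := by
  have hg : |inner ℝ u y| ≤ ‖y‖ := by
    simpa [hu] using abs_real_inner_le_norm u y
  have hnonneg := abs_nonneg (inner ℝ u y)
  rw [← sq_abs (inner ℝ u y)]
  generalize |inner ℝ u y| = g at *
  rcases hnonneg.eq_or_lt with rfl | hg0
  · simpa using by positivity
  have hy : 0 < ‖y‖ := hg0.trans_le hg
  set b : ℝ := (g / ‖y‖) ^ (2 - α) with hb
  have hab : g ^ 2 * (‖y‖ ^ (α - 2) * g ^ 2) = g ^ (2 + α) * b := by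
    rw [hb, Real.div_rpow hg0.le hy.le, ← mul_div_assoc, ← Real.rpow_add hg0,
      show 2 + α + (2 - α) = (4 : ℕ) by push_cast; ring, Real.rpow_natCast,
      show α - 2 = -(2 - α) by ring, Real.rpow_neg hy.le]
    field_simp
  have hb2 : b ^ 2 ≤ g ^ 2 / ‖y‖ ^ 2 := by
    rw [hb, ← Real.rpow_two, ← Real.rpow_mul (by positivity), ← div_pow, ← Real.rpow_two]
    exact Real.rpow_le_rpow_of_exponent_ge (by positivity) (div_le_one_of_le₀ hg hy.le)
      (by linarith)
  have ha2 : (g ^ (2 + α)) ^ 2 = g ^ (4 + 2 * α) := by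
    rw [← Real.rpow_two, ← Real.rpow_mul hg0.le]
    ring_nf
  calc (g ^ 2 - 1) * (‖y‖ ^ (α - 2) * g ^ 2) ≤ g ^ 2 * (‖y‖ ^ (α - 2) * g ^ 2) := by
        gcongr
        linarith
    _ = g ^ (2 + α) * b := hab
    _ ≤ δ * (g ^ (2 + α)) ^ 2 + δ⁻¹ * b ^ 2 := by
        have h0 : 0 < g ^ (2 + α) := by positivity
        have h1 : 0 < b := by positivity
        have h2 : δ * (g ^ (2 + α)) ^ 2 + δ⁻¹ * b ^ 2 - g ^ (2 + α) * b =
          δ⁻¹ * ((δ * g ^ (2 + α) - b) ^ 2 + δ * (g ^ (2 + α) * b)) := by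
          field_simp
          ring
        have h3 : 0 ≤ δ⁻¹ * ((δ * g ^ (2 + α) - b) ^ 2 + δ * (g ^ (2 + α) * b)) := by positivity
        linarith
    _ ≤ _ := by
        rw [ha2]
        gcongr

end PointwiseBounds

section MomentBounds

variable {E : Type*} [NormedAddCommGroup E] [InnerProductSpace ℝ E] [FiniteDimensional ℝ E]
  [MeasurableSpace E] [BorelSpace E]

lemma integral_inner_sq_div_norm_sq_eq {u v : E} (hu : ‖u‖ = 1) (hv : ‖v‖ = 1) :
    ∫ x, (inner ℝ u x) ^ 2 / ‖x‖ ^ 2 ∂(stdGaussian E) =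
      ∫ x, (inner ℝ v x) ^ 2 / ‖x‖ ^ 2 ∂(stdGaussian E) := by
  let f : E ≃ₗᵢ[ℝ] E := (Submodule.span ℝ {u - v})ᗮ.reflection
  have hf : f u = v := Submodule.reflection_sub (hu.trans hv.symm)
  have h : (stdGaussian E).map f = stdGaussian E := stdGaussian_map f
  conv_rhs => rw [← h]
  rw [integral_map (by fun_prop) (Measurable.aestronglyMeasurable (by fun_prop))]
  simp_rw [← hf, f.inner_map_map, f.norm_map]

lemma integrable_inner_sq_div_norm_sq {u : E} (hu : ‖u‖ = 1) :
    Integrable (fun x => (inner ℝ u x) ^ 2 / ‖x‖ ^ 2) (stdGaussian E) := by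
  refine (integrable_const (1 : ℝ)).mono'
    (Measurable.aestronglyMeasurable (by fun_prop)) (ae_of_all _ fun x => ?_)
  rw [Real.norm_of_nonneg (by positivity)]
  exact abs_inner_sq_div_norm_sq_le hu x

lemma finrank_mul_integral_inner_sq_div_norm_sq_le {u : E} (hu : ‖u‖ = 1) :
    Module.finrank ℝ E * ∫ x, (inner ℝ u x) ^ 2 / ‖x‖ ^ 2 ∂(stdGaussian E) ≤ 1 := by
  set b := stdOrthonormalBasis ℝ E
  have hb : ∀ i, ‖b i‖ = 1 := b.norm_eq_one
  calc Module.finrank ℝ E * ∫ x, (inner ℝ u x) ^ 2 / ‖x‖ ^ 2 ∂(stdGaussian E)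
      = ∑ i, ∫ x, (inner ℝ (b i) x) ^ 2 / ‖x‖ ^ 2 ∂(stdGaussian E) := by
        simp_rw [fun i => integral_inner_sq_div_norm_sq_eq (hb i) hu]
        simp
    _ = ∫ x, ‖x‖ ^ 2 / ‖x‖ ^ 2 ∂(stdGaussian E) := by
        rw [← integral_finsetSum _ fun i _ => integrable_inner_sq_div_norm_sq (hb i)]
        simp_rw [← Finset.sum_div, b.sum_sq_inner_right]
    _ ≤ ∫ _, 1 ∂(stdGaussian E) := by
        refine integral_mono_of_nonneg (ae_of_all _ fun x => by positivity) (integrable_const _)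
          (ae_of_all _ fun x => div_self_le_one _)
    _ = 1 := by simp

/-- A bound for `∫ (⟪u, x⟫ ^ 2 - 1) ^ 2 * |⟪e, x⟫| ^ β` over unit vectors `u` and `e`. -/
noncomputable def momentBound (β : ℝ) : ℝ :=
  ∫ t : ℝ, (t ^ 2 - 1) ^ 4 ∂(gaussianReal 0 1) + ∫ t : ℝ, |t| ^ (2 * β) ∂(gaussianReal 0 1)

lemma momentBound_nonneg (β : ℝ) : 0 ≤ momentBound β :=
  add_nonneg (integral_nonneg fun _ => by positivity) (integral_nonneg fun _ => by positivity)

lemma integrable_hermite_sq_mul_rpow {β : ℝ} (hβ : 0 ≤ β) {u e : E} (hu : ‖u‖ = 1)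
    (he : ‖e‖ = 1) :
    Integrable (fun x => ((inner ℝ u x) ^ 2 - 1) ^ 2 * |inner ℝ e x| ^ β) (stdGaussian E) := by
  refine ((integrable_inner_stdGaussian hu integrable_hermite_pow_four).add
    (integrable_inner_stdGaussian he (integrable_abs_rpow_gaussianReal
      (by positivity : 0 ≤ 2 * β)))).mono' (by fun_prop) (ae_of_all _ fun x => ?_)
  rw [Real.norm_of_nonneg (by positivity)]
  exact hermite_sq_mul_rpow_le _ _ _

lemma integral_hermite_sq_mul_rpow_le {β : ℝ} (hβ : 0 ≤ β) {u e : E} (hu : ‖u‖ = 1)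
    (he : ‖e‖ = 1) :
    ∫ x, ((inner ℝ u x) ^ 2 - 1) ^ 2 * |inner ℝ e x| ^ β ∂(stdGaussian E) ≤ momentBound β := by
  have h1 := integrable_hermite_pow_four
  have h2 := integrable_abs_rpow_gaussianReal (by positivity : 0 ≤ 2 * β)
  rw [momentBound, ← integral_inner_stdGaussian hu h1, ← integral_inner_stdGaussian he h2,
    ← integral_add (integrable_inner_stdGaussian hu h1) (integrable_inner_stdGaussian he h2)]
  exact integral_mono (integrable_hermite_sq_mul_rpow hβ hu he)
    ((integrable_inner_stdGaussian hu h1).add (integrable_inner_stdGaussian he h2))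
    fun x => hermite_sq_mul_rpow_le _ _ _

lemma integral_hermite_sq_mul_abs_inner_rpow_le {β : ℝ} (hβ : 0 < β) {u : E} (hu : ‖u‖ = 1)
    (y : E) :
    ∫ x, ((inner ℝ u x) ^ 2 - 1) ^ 2 * |inner ℝ x y| ^ β ∂(stdGaussian E) ≤
      momentBound β * ‖y‖ ^ β := by
  rcases eq_or_ne y 0 with rfl | hy
  · simp [Real.zero_rpow hβ.ne']
  have hy0 : 0 < ‖y‖ := norm_pos_iff.2 hy
  have h := integral_hermite_sq_mul_rpow_le hβ.le hu (norm_smul_inv_norm (𝕜 := ℝ) hy)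
  simp only [RCLike.ofReal_real_eq_id, id_eq] at h
  have h1 : ∀ x : E, |inner ℝ x y| ^ β = ‖y‖ ^ β * |inner ℝ (((‖y‖ : ℝ)⁻¹) • y) x| ^ β := by
    intro x
    rw [← Real.mul_rpow hy0.le (abs_nonneg _), inner_smul_left, abs_mul]
    simp [real_inner_comm, hy0.ne']
  simp_rw [h1, mul_left_comm _ (‖y‖ ^ β)]
  rw [integral_const_mul, mul_comm]
  gcongr

lemma integrable_and_integral_hermite_sq_mul_norm_rpow_le {α : ℝ} (hα0 : 0 < α) (hα1 : α ≤ 1)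
    {u : E} (hu : ‖u‖ = 1) :
    Integrable (fun x => ((inner ℝ u x) ^ 2 - 1) ^ 2 * ‖x‖ ^ (2 * α)) (stdGaussian E) ∧
    ∫ x, ((inner ℝ u x) ^ 2 - 1) ^ 2 * ‖x‖ ^ (2 * α) ∂(stdGaussian E) ≤
      (momentBound 0 + momentBound 2) * (Module.finrank ℝ E : ℝ) ^ α := by
  have hne : Nontrivial E := ⟨u, 0, fun h => by simp [h] at hu⟩
  obtain ⟨n, hn_def⟩ : ∃ n : ℝ, n = Module.finrank ℝ E := ⟨_, rfl⟩
  have hn : 0 < n := by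
    rw [hn_def]
    exact_mod_cast Module.finrank_pos (R := ℝ) (M := E)
  rw [← hn_def]
  set b := stdOrthonormalBasis ℝ E
  have hb : ∀ i, ‖b i‖ = 1 := b.norm_eq_one
  have hi0 := integrable_hermite_sq_mul_rpow le_rfl hu hu
  have hi2 := fun i => integrable_hermite_sq_mul_rpow (zero_le_two) hu (hb i)
  have hi : Integrable (fun x => n ^ α * (((inner ℝ u x) ^ 2 - 1) ^ 2 * |inner ℝ u x| ^ (0 : ℝ) +
      n⁻¹ * ∑ i, ((inner ℝ u x) ^ 2 - 1) ^ 2 * |inner ℝ (b i) x| ^ (2 : ℝ))) (stdGaussian E) :=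
    (hi0.add ((integrable_finsetSum _ fun i _ => hi2 i).const_mul _)).const_mul _
  have hle : ∀ x : E, ((inner ℝ u x) ^ 2 - 1) ^ 2 * ‖x‖ ^ (2 * α) ≤
      n ^ α * (((inner ℝ u x) ^ 2 - 1) ^ 2 * |inner ℝ u x| ^ (0 : ℝ) +
      n⁻¹ * ∑ i, ((inner ℝ u x) ^ 2 - 1) ^ 2 * |inner ℝ (b i) x| ^ (2 : ℝ)) := by
    intro x
    have h := mul_le_mul_of_nonneg_left (rpow_two_mul_le hα0 hα1 hn ‖x‖ (norm_nonneg x))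
      (sq_nonneg ((inner ℝ u x) ^ 2 - 1))
    refine h.trans_eq ?_
    simp_rw [Real.rpow_two, sq_abs, ← Finset.mul_sum, b.sum_sq_inner_right, Real.rpow_zero]
    ring
  have hint : Integrable (fun x => ((inner ℝ u x) ^ 2 - 1) ^ 2 * ‖x‖ ^ (2 * α))
      (stdGaussian E) := by
    refine hi.mono' (by fun_prop) (ae_of_all _ fun x => ?_)
    rw [Real.norm_of_nonneg (by positivity)]
    exact hle x
  refine ⟨hint, (integral_mono hint hi hle).trans ?_⟩
  rw [integral_const_mul,
    integral_add hi0 ((integrable_finsetSum _ fun i _ => hi2 i).const_mul _), integral_const_mul,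
    integral_finsetSum _ fun i _ => hi2 i, mul_comm]
  gcongr
  · exact integral_hermite_sq_mul_rpow_le le_rfl hu hu
  · calc n⁻¹ * ∑ i, ∫ x, ((inner ℝ u x) ^ 2 - 1) ^ 2 * |inner ℝ (b i) x| ^ (2 : ℝ)
          ∂(stdGaussian E)
        ≤ n⁻¹ * ∑ _i : Fin (Module.finrank ℝ E), momentBound 2 := by
          gcongr with i
          exact integral_hermite_sq_mul_rpow_le zero_le_two hu (hb i)
      _ = momentBound 2 := by
          rw [Finset.sum_const, Finset.card_univ, Fintype.card_fin, nsmul_eq_mul, ← hn_def,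
            inv_mul_cancel_left₀ hn.ne']

/-- The off-diagonal terms of the quadratic form. -/
noncomputable def hermiteKernel (u : E) (α : ℝ) (p : E × E) : ℝ :=
  ((inner ℝ u p.1) ^ 2 - 1) * ((inner ℝ u p.2) ^ 2 - 1) * |inner ℝ p.1 p.2| ^ α

@[fun_prop]
lemma measurable_hermiteKernel (u : E) (α : ℝ) : Measurable (hermiteKernel u α) := by
  unfold hermiteKernel
  fun_prop

lemma integrable_hermiteKernel_sq {α : ℝ} (hα0 : 0 < α) (hα1 : α ≤ 1) {u : E} (hu : ‖u‖ = 1) :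
    Integrable (fun p => hermiteKernel u α p ^ 2) ((stdGaussian E).prod (stdGaussian E)) := by
  have h := (integrable_and_integral_hermite_sq_mul_norm_rpow_le hα0 hα1 hu).1
  refine (h.mul_prod h).mono' (by fun_prop) (ae_of_all _ fun p => ?_)
  rw [Real.norm_of_nonneg (by positivity)]
  have h1 : (|inner ℝ p.1 p.2| ^ α) ^ 2 ≤ ‖p.1‖ ^ (2 * α) * ‖p.2‖ ^ (2 * α) := by
    rw [← Real.mul_rpow (by positivity) (by positivity), mul_comm 2 α,
      Real.rpow_mul (by positivity), Real.rpow_two]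
    gcongr
    exact abs_real_inner_le_norm _ _
  calc hermiteKernel u α p ^ 2
      = ((inner ℝ u p.1) ^ 2 - 1) ^ 2 * ((inner ℝ u p.2) ^ 2 - 1) ^ 2 *
          (|inner ℝ p.1 p.2| ^ α) ^ 2 := by rw [hermiteKernel]; ring
    _ ≤ ((inner ℝ u p.1) ^ 2 - 1) ^ 2 * ((inner ℝ u p.2) ^ 2 - 1) ^ 2 *
          (‖p.1‖ ^ (2 * α) * ‖p.2‖ ^ (2 * α)) := by gcongr
    _ = _ := by ring

lemma memLp_hermiteKernel {α : ℝ} (hα0 : 0 < α) (hα1 : α ≤ 1) {u : E} (hu : ‖u‖ = 1) :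
    MemLp (hermiteKernel u α) 2 ((stdGaussian E).prod (stdGaussian E)) :=
  (memLp_two_iff_integrable_sq (by fun_prop)).2 (integrable_hermiteKernel_sq hα0 hα1 hu)

lemma integral_hermiteKernel_sq_le {α : ℝ} (hα0 : 0 < α) (hα1 : α ≤ 1) {u : E} (hu : ‖u‖ = 1) :
    ∫ p, hermiteKernel u α p ^ 2 ∂((stdGaussian E).prod (stdGaussian E)) ≤
      momentBound (2 * α) * ((momentBound 0 + momentBound 2) *
        (Module.finrank ℝ E : ℝ) ^ α) := by
  have h := integrable_and_integral_hermite_sq_mul_norm_rpow_le hα0 hα1 hu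
  rw [integral_prod_symm _ (integrable_hermiteKernel_sq hα0 hα1 hu)]
  calc ∫ y, ∫ x, hermiteKernel u α (x, y) ^ 2 ∂(stdGaussian E) ∂(stdGaussian E)
      ≤ ∫ y, momentBound (2 * α) * (((inner ℝ u y) ^ 2 - 1) ^ 2 * ‖y‖ ^ (2 * α))
          ∂(stdGaussian E) := by
        refine integral_mono (integrable_hermiteKernel_sq hα0 hα1 hu).integral_prod_right
          (h.1.const_mul _) fun y => ?_
        have he : ∀ x : E, hermiteKernel u α (x, y) ^ 2 = ((inner ℝ u y) ^ 2 - 1) ^ 2 *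
            (((inner ℝ u x) ^ 2 - 1) ^ 2 * |inner ℝ x y| ^ (2 * α)) := by
          intro x
          rw [hermiteKernel, mul_comm 2 α, Real.rpow_mul (abs_nonneg _), Real.rpow_two]
          ring
        simp_rw [he]
        rw [integral_const_mul, mul_left_comm]
        gcongr
        exact integral_hermite_sq_mul_abs_inner_rpow_le (by positivity) hu y
    _ ≤ _ := by
        rw [integral_const_mul]
        exact mul_le_mul_of_nonneg_left h.2 (momentBound_nonneg _)

lemma integral_hermiteKernel_le {α : ℝ} (hα0 : 0 < α) (hα1 : α ≤ 1) {u : E} (hu : ‖u‖ = 1)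
    {δ : ℝ} (hδ : 0 < δ) :
    ∫ p, hermiteKernel u α p ∂((stdGaussian E).prod (stdGaussian E)) ≤
      hermiteCoeff α * (δ * ∫ t : ℝ, |t| ^ (4 + 2 * α) ∂(gaussianReal 0 1) +
        δ⁻¹ * (Module.finrank ℝ E : ℝ)⁻¹) := by
  have hne : Nontrivial E := ⟨u, 0, fun h => by simp [h] at hu⟩
  have hn : 0 < (Module.finrank ℝ E : ℝ) := by
    exact_mod_cast Module.finrank_pos (R := ℝ) (M := E)
  have hint : Integrable (hermiteKernel u α) ((stdGaussian E).prod (stdGaussian E)) :=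
    (memLp_hermiteKernel hα0 hα1 hu).integrable one_le_two
  have hi1 := integrable_inner_stdGaussian hu
    (integrable_abs_rpow_gaussianReal (by positivity : 0 ≤ 4 + 2 * α))
  have hi2 := integrable_inner_sq_div_norm_sq hu
  rw [integral_prod_symm _ hint]
  calc ∫ y, ∫ x, hermiteKernel u α (x, y) ∂(stdGaussian E) ∂(stdGaussian E)
      ≤ ∫ y, hermiteCoeff α * (δ * |inner ℝ u y| ^ (4 + 2 * α) +
          δ⁻¹ * ((inner ℝ u y) ^ 2 / ‖y‖ ^ 2)) ∂(stdGaussian E) := by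
        refine integral_mono hint.integral_prod_right
          (((hi1.const_mul _).add (hi2.const_mul _)).const_mul _) fun y => ?_
        have he : ∀ x : E, hermiteKernel u α (x, y) = ((inner ℝ u y) ^ 2 - 1) *
            (((inner ℝ u x) ^ 2 - 1) * |inner ℝ x y| ^ α) := by
          intro x
          rw [hermiteKernel]
          ring
        simp_rw [he]
        rw [integral_const_mul, integral_hermite_mul_abs_inner_rpow hα0 hu, mul_left_comm]
        exact mul_le_mul_of_nonneg_left (hermite_mul_rpow_le hα1 hδ hu y)
          (hermiteCoeff_pos hα0).le
    _ ≤ _ := by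
        rw [integral_const_mul, integral_add (hi1.const_mul _) (hi2.const_mul _),
          integral_const_mul, integral_const_mul, integral_inner_stdGaussian hu
          (integrable_abs_rpow_gaussianReal (by positivity : 0 ≤ 4 + 2 * α))]
        have := finrank_mul_integral_inner_sq_div_norm_sq_le hu
        rw [← le_inv_mul_iff₀ hn, mul_one] at this
        have := (hermiteCoeff_pos hα0).le
        gcongr

end MomentBounds

section UStatistic

variable {F : Type*} [MeasurableSpace F] {ν : Measure F} [IsProbabilityMeasure ν]
  {ι : Type*} [Fintype ι] [DecidableEq ι]

omit [DecidableEq ι] in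
lemma iIndepFun_eval_pi : iIndepFun (fun (i : ι) (y : ι → F) => y i) (Measure.pi fun _ => ν) :=
  iIndepFun_pi (X := fun _ => id) fun _ => aemeasurable_id

omit [DecidableEq ι] in
lemma measurePreserving_pair {j k : ι} (hjk : j ≠ k) :
    MeasurePreserving (fun y : ι → F => (y j, y k)) (Measure.pi fun _ => ν) (ν.prod ν) := by
  refine ⟨by fun_prop, ?_⟩
  have h := (iIndepFun_eval_pi (ν := ν)).indepFun hjk
  rw [indepFun_iff_map_prod_eq_prod_map_map
    (measurable_pi_apply j).aemeasurable (measurable_pi_apply k).aemeasurable] at h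
  rw [h, (measurePreserving_eval (fun _ : ι => ν) j).map_eq,
    (measurePreserving_eval (fun _ : ι => ν) k).map_eq]

omit [DecidableEq ι] in
lemma integral_offDiag_sum {q : F × F → ℝ} (hq : MemLp q 2 (ν.prod ν)) :
    ∫ y, ∑ p ∈ (univ : Finset ι).offDiag, q (y p.1, y p.2) ∂(Measure.pi fun _ : ι => ν) =
      ((univ : Finset ι).offDiag.card : ℝ) * ∫ p, q p ∂(ν.prod ν) := by
  have hmp : ∀ p ∈ (univ : Finset ι).offDiag, MeasurePreserving
      (fun y : ι → F => (y p.1, y p.2)) (Measure.pi fun _ => ν) (ν.prod ν) :=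
    fun p hp => measurePreserving_pair (mem_offDiag.1 hp).2.2
  have hI : ∀ p ∈ (univ : Finset ι).offDiag,
      Integrable (fun y : ι → F => q (y p.1, y p.2)) (Measure.pi fun _ => ν) :=
    fun p hp => (hmp p hp).integrable_comp_of_integrable (hq.integrable one_le_two)
  rw [integral_finsetSum _ hI]
  rw [Finset.sum_congr rfl fun p hp => ?_, Finset.sum_const, nsmul_eq_mul]
  rw [← (hmp p hp).map_eq, integral_map (hmp p hp).aemeasurable]
  rw [(hmp p hp).map_eq]
  exact hq.1

lemma covariance_le_of_variance_le {Ω : Type*} [MeasurableSpace Ω] {P : Measure Ω}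
    [IsProbabilityMeasure P] {X Y : Ω → ℝ} {V : ℝ} (hX : MemLp X 2 P) (hY : MemLp Y 2 P)
    (hVX : Var[X; P] ≤ V) (hVY : Var[Y; P] ≤ V) : cov[X, Y; P] ≤ V := by
  have hX' : MemLp (fun ω => X ω - P[X]) 2 P := hX.sub (memLp_const _)
  have hY' : MemLp (fun ω => Y ω - P[Y]) 2 P := hY.sub (memLp_const _)
  rw [variance_eq_integral hX.aemeasurable] at hVX
  rw [variance_eq_integral hY.aemeasurable] at hVY
  have h : cov[X, Y; P] ≤ ∫ ω, (2⁻¹ * (X ω - P[X]) ^ 2 + 2⁻¹ * (Y ω - P[Y]) ^ 2) ∂P := by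
    refine integral_mono (hX'.integrable_mul hY')
      ((hX'.integrable_sq.const_mul _).add (hY'.integrable_sq.const_mul _)) fun ω => ?_
    simp only
    nlinarith [sq_nonneg ((X ω - P[X]) - (Y ω - P[Y]))]
  rw [integral_add (hX'.integrable_sq.const_mul _) (hY'.integrable_sq.const_mul _),
    integral_const_mul, integral_const_mul] at h
  linarith

lemma variance_offDiag_sum_le {q : F × F → ℝ} (hqm : Measurable q) (hq : MemLp q 2 (ν.prod ν)) :
    Var[fun y => ∑ p ∈ (univ : Finset ι).offDiag, q (y p.1, y p.2); Measure.pi fun _ : ι => ν] ≤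
      4 * (Fintype.card ι : ℝ) ^ 3 * ∫ p, q p ^ 2 ∂(ν.prod ν) := by
  set V := ∫ p, q p ^ 2 ∂(ν.prod ν) with hV
  have hV0 : 0 ≤ V := integral_nonneg fun _ => sq_nonneg _
  have hmp : ∀ p ∈ (univ : Finset ι).offDiag, MeasurePreserving
      (fun y : ι → F => (y p.1, y p.2)) (Measure.pi fun _ => ν) (ν.prod ν) :=
    fun p hp => measurePreserving_pair (mem_offDiag.1 hp).2.2
  have hL : ∀ p ∈ (univ : Finset ι).offDiag, MemLp (fun y : ι → F => q (y p.1, y p.2)) 2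
      (Measure.pi fun _ => ν) := fun p hp => hq.comp_measurePreserving (hmp p hp)
  have hvar : ∀ p ∈ (univ : Finset ι).offDiag,
      Var[fun y : ι → F => q (y p.1, y p.2); Measure.pi fun _ => ν] ≤ V := by
    intro p hp
    refine (variance_le_expectation_sq (hL p hp).1).trans_eq ?_
    rw [hV, ← (hmp p hp).map_eq, integral_map (hmp p hp).aemeasurable]
    · rfl
    · rw [(hmp p hp).map_eq]
      exact hq.integrable_sq.1
  rw [variance_fun_sum' hL]
  have hcov : ∀ p ∈ (univ : Finset ι).offDiag, ∀ r ∈ (univ : Finset ι).offDiag,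
      cov[fun y : ι → F => q (y p.1, y p.2), fun y => q (y r.1, y r.2); Measure.pi fun _ => ν] ≤
      (if p.1 = r.1 then V else 0) + (if p.1 = r.2 then V else 0) +
      (if p.2 = r.1 then V else 0) + (if p.2 = r.2 then V else 0) := by
    intro p hp r hr
    by_cases h : p.1 ≠ r.1 ∧ p.1 ≠ r.2 ∧ p.2 ≠ r.1 ∧ p.2 ≠ r.2
    · have hind0 := (iIndepFun_eval_pi (ν := ν)).indepFun_prodMk_prodMk
        (fun i => measurable_pi_apply i) p.1 p.2 r.1 r.2 h.1 h.2.1 h.2.2.1 h.2.2.2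
      have hind : IndepFun (fun y : ι → F => q (y p.1, y p.2)) (fun y => q (y r.1, y r.2))
          (Measure.pi fun _ => ν) := hind0.comp hqm hqm
      rw [hind.covariance_eq_zero (hL p hp) (hL r hr)]
      positivity
    · have hle := covariance_le_of_variance_le (hL p hp) (hL r hr) (hvar p hp) (hvar r hr)
      split_ifs <;> first | linarith | tauto
  calc _ ≤ ∑ p ∈ (univ : Finset ι).offDiag, ∑ r ∈ (univ : Finset ι).offDiag,
        ((if p.1 = r.1 then V else 0) + (if p.1 = r.2 then V else 0) +
        (if p.2 = r.1 then V else 0) + (if p.2 = r.2 then V else 0)) :=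
        Finset.sum_le_sum fun p hp => Finset.sum_le_sum fun r hr => hcov p hp r hr
    _ ≤ ∑ p : ι × ι, ∑ r : ι × ι,
        ((if p.1 = r.1 then V else 0) + (if p.1 = r.2 then V else 0) +
        (if p.2 = r.1 then V else 0) + (if p.2 = r.2 then V else 0)) := by
        have h0 : ∀ p r : ι × ι, 0 ≤ (if p.1 = r.1 then V else 0) +
            (if p.1 = r.2 then V else 0) + (if p.2 = r.1 then V else 0) +
            (if p.2 = r.2 then V else 0) := by
          intro p r
          positivity
        refine (Finset.sum_le_sum fun p _ => Finset.sum_le_sum_of_subset_of_nonneg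
          (subset_univ _) fun r _ _ => h0 p r).trans ?_
        exact Finset.sum_le_sum_of_subset_of_nonneg (subset_univ _)
          fun p _ _ => Finset.sum_nonneg fun r _ => h0 p r
    _ = 4 * (Fintype.card ι : ℝ) ^ 3 * V := by
        have h1 : ∀ a : ι, ∑ r : ι × ι, (if a = r.1 then V else 0) = Fintype.card ι * V := by
          intro a
          rw [Fintype.sum_prod_type_right]
          simp
        have h2 : ∀ a : ι, ∑ r : ι × ι, (if a = r.2 then V else 0) = Fintype.card ι * V := by
          intro a
          rw [Fintype.sum_prod_type]
          simp
        simp only [Finset.sum_add_distrib, h1, h2, Finset.sum_const, Finset.card_univ,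
          Fintype.card_prod, nsmul_eq_mul]
        push_cast
        ring

end UStatistic

section TestVector

lemma sq_mul_measureReal_abs_sub_ge_le_variance {Ω : Type*} [MeasurableSpace Ω] {P : Measure Ω}
    [IsProbabilityMeasure P] {X : Ω → ℝ} (hX : MemLp X 2 P) {c : ℝ} (hc : 0 < c) :
    P.real {ω | c ≤ |X ω - P[X]|} ≤ Var[X; P] / c ^ 2 :=
  ENNReal.toReal_le_of_le_ofReal (div_nonneg (variance_nonneg _ _) (by positivity))
    (meas_ge_le_variance_div_sq hX hc)

variable {E : Type*} [NormedAddCommGroup E] [InnerProductSpace ℝ E] [FiniteDimensional ℝ E]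
  [MeasurableSpace E] [BorelSpace E] {ι : Type*} [Fintype ι] [DecidableEq ι]

/-- The constant in the bound for the failure probability of the test vector. -/
noncomputable def failureConst (α : ℝ) : ℝ :=
  4 * (∫ t : ℝ, ((t ^ 2 - 1) * |t| ^ α) ^ 2 ∂(gaussianReal 0 1)) / hermiteCoeff α ^ 2 +
    (16 / hermiteCoeff α ^ 2 + 4 * momentBound (2 * α) * (32 / hermiteCoeff α ^ 2) ^ 2) *
      (momentBound 0 + momentBound 2)

omit [DecidableEq ι] in
lemma measureReal_linear_le {α : ℝ} (hα0 : 0 < α) {u : E} (hu : ‖u‖ = 1) (hι : 0 < Fintype.card ι) :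
    (Measure.pi fun _ : ι => stdGaussian E).real
      {y | ∑ j, ((inner ℝ u (y j)) ^ 2 - 1) * |inner ℝ u (y j)| ^ α ≤
        Fintype.card ι * hermiteCoeff α / 2} ≤
      4 * (∫ t : ℝ, ((t ^ 2 - 1) * |t| ^ α) ^ 2 ∂(gaussianReal 0 1)) / hermiteCoeff α ^ 2 /
        Fintype.card ι := by
  have hN : 0 < (Fintype.card ι : ℝ) := by exact_mod_cast hι
  have hκ := hermiteCoeff_pos hα0
  set N : ℝ := (Fintype.card ι : ℝ) with hN_def
  set κ := hermiteCoeff α with hκ_def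
  set V := ∫ t : ℝ, ((t ^ 2 - 1) * |t| ^ α) ^ 2 ∂(gaussianReal 0 1) with hV
  set P := Measure.pi fun _ : ι => stdGaussian E with hP
  set f : E → ℝ := fun x => ((inner ℝ u x) ^ 2 - 1) * |inner ℝ u x| ^ α with hf
  have hfm : Measurable f := by fun_prop
  have hfL : MemLp f 2 (stdGaussian E) :=
    (memLp_two_iff_integrable_sq (by fun_prop)).2
      (integrable_inner_stdGaussian hu (integrable_sq_hermiteCoeff hα0))
  have hmp : ∀ j : ι, MeasurePreserving (fun y : ι → E => y j) P (stdGaussian E) :=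
    fun j => measurePreserving_eval (fun _ : ι => stdGaussian E) j
  have hL : ∀ j : ι, MemLp (fun y : ι → E => f (y j)) 2 P :=
    fun j => hfL.comp_measurePreserving (hmp j)
  have hSL : MemLp (fun y : ι → E => ∑ j, f (y j)) 2 P := memLp_finsetSum _ fun j _ => hL j
  have hmean : ∫ y, ∑ j, f (y j) ∂P = N * κ := by
    rw [integral_finsetSum (f := fun j (y : ι → E) => f (y j)) _
      fun j _ => (hL j).integrable one_le_two]
    have : ∀ j : ι, ∫ y, f (y j) ∂P = κ := by
      intro j
      rw [hκ_def, hermiteCoeff, ← integral_inner_stdGaussian hu (integrable_hermiteCoeff hα0),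
        ← (hmp j).map_eq, integral_map (hmp j).aemeasurable
          (by rw [(hmp j).map_eq]; exact hfL.1)]
    simp [this, hN_def]
  have hvar : Var[fun y : ι → E => ∑ j, f (y j); P] ≤ N * V := by
    have h := variance_sum_pi (μ := fun _ : ι => stdGaussian E) (X := fun _ => f) fun _ => hfL
    have h2 : (∑ i, fun y : ι → E => f (y i)) = fun y => ∑ j, f (y j) := by
      ext y; simp
    rw [h2] at h
    rw [hP, h, Finset.sum_const, Finset.card_univ, nsmul_eq_mul]
    gcongr
    refine (variance_le_expectation_sq hfL.1).trans_eq ?_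
    rw [hV, ← integral_inner_stdGaussian hu (integrable_sq_hermiteCoeff hα0)]
    rfl
  calc P.real {y | ∑ j, f (y j) ≤ N * κ / 2}
      ≤ P.real {y | N * κ / 2 ≤ |∑ j, f (y j) - ∫ z, ∑ j, f (z j) ∂P|} := by
        refine measureReal_mono fun y hy => ?_
        simp only [Set.mem_ofPred_eq] at hy ⊢
        rw [hmean]
        exact le_abs.2 (Or.inr (by linarith))
    _ ≤ Var[fun y : ι → E => ∑ j, f (y j); P] / (N * κ / 2) ^ 2 :=
        sq_mul_measureReal_abs_sub_ge_le_variance hSL (by positivity)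
    _ ≤ N * V / (N * κ / 2) ^ 2 := by gcongr
    _ = 4 * V / κ ^ 2 / N := by field_simp; norm_num

omit [DecidableEq ι] in
lemma measureReal_diag_le {α : ℝ} (hα0 : 0 < α) (hα1 : α ≤ 1) {u : E} (hu : ‖u‖ = 1)
    (hι : 0 < Fintype.card ι) :
    (Measure.pi fun _ : ι => stdGaussian E).real
      {y | (Fintype.card ι : ℝ) ^ 2 * hermiteCoeff α ^ 2 / 16 ≤
        ∑ j, ((inner ℝ u (y j)) ^ 2 - 1) ^ 2 * ‖y j‖ ^ (2 * α)} ≤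
      16 / hermiteCoeff α ^ 2 * (momentBound 0 + momentBound 2) *
        (Module.finrank ℝ E : ℝ) ^ α / Fintype.card ι := by
  have hN : 0 < (Fintype.card ι : ℝ) := by exact_mod_cast hι
  have hκ := hermiteCoeff_pos hα0
  set N : ℝ := (Fintype.card ι : ℝ) with hN_def
  set κ := hermiteCoeff α with hκ_def
  set P := Measure.pi fun _ : ι => stdGaussian E with hP
  set f : E → ℝ := fun x => ((inner ℝ u x) ^ 2 - 1) ^ 2 * ‖x‖ ^ (2 * α) with hf
  obtain ⟨hfi, hfle⟩ := integrable_and_integral_hermite_sq_mul_norm_rpow_le hα0 hα1 hu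
  have hmp : ∀ j : ι, MeasurePreserving (fun y : ι → E => y j) P (stdGaussian E) :=
    fun j => measurePreserving_eval (fun _ : ι => stdGaussian E) j
  have hI : ∀ j : ι, Integrable (fun y : ι → E => f (y j)) P :=
    fun j => (hmp j).integrable_comp_of_integrable hfi
  have hmean : ∫ y, ∑ j, f (y j) ∂P ≤
      N * ((momentBound 0 + momentBound 2) * (Module.finrank ℝ E : ℝ) ^ α) := by
    rw [integral_finsetSum (f := fun j (y : ι → E) => f (y j)) _ fun j _ => hI j]
    have : ∀ j : ι, ∫ y, f (y j) ∂P ≤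
        (momentBound 0 + momentBound 2) * (Module.finrank ℝ E : ℝ) ^ α := by
      intro j
      refine le_trans (le_of_eq ?_) hfle
      rw [← (hmp j).map_eq, integral_map (hmp j).aemeasurable
          (by rw [(hmp j).map_eq]; exact hfi.1)]
    refine (Finset.sum_le_sum fun j _ => this j).trans_eq ?_
    rw [Finset.sum_const, Finset.card_univ, nsmul_eq_mul]
  have h := mul_meas_ge_le_integral_of_nonneg (μ := P) (f := fun y => ∑ j, f (y j))
    (ae_of_all _ fun y => Finset.sum_nonneg fun j _ => by positivity)
    (integrable_finsetSum _ fun j _ => hI j) (N ^ 2 * κ ^ 2 / 16)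
  rw [← le_div_iff₀' (by positivity)] at h
  refine h.trans ?_
  calc _ ≤ N * ((momentBound 0 + momentBound 2) * (Module.finrank ℝ E : ℝ) ^ α) /
        (N ^ 2 * κ ^ 2 / 16) := by gcongr
    _ = _ := by field_simp

lemma measureReal_offDiag_le {α : ℝ} (hα0 : 0 < α) (hα1 : α ≤ 1) {u : E} (hu : ‖u‖ = 1)
    (hι : 0 < Fintype.card ι)
    (hq : ∫ p, hermiteKernel u α p ∂((stdGaussian E).prod (stdGaussian E)) ≤
      hermiteCoeff α ^ 2 / 32) :
    (Measure.pi fun _ : ι => stdGaussian E).real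
      {y | (Fintype.card ι : ℝ) ^ 2 * hermiteCoeff α ^ 2 / 16 ≤
        ∑ p ∈ (univ : Finset ι).offDiag, hermiteKernel u α (y p.1, y p.2)} ≤
      4 * momentBound (2 * α) * (32 / hermiteCoeff α ^ 2) ^ 2 *
        (momentBound 0 + momentBound 2) * (Module.finrank ℝ E : ℝ) ^ α / Fintype.card ι := by
  have hN : 0 < (Fintype.card ι : ℝ) := by exact_mod_cast hι
  have hκ := hermiteCoeff_pos hα0
  have hqL := memLp_hermiteKernel hα0 hα1 hu
  have hmean := integral_offDiag_sum (ι := ι) hqL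
  have hvar := variance_offDiag_sum_le (ι := ι) (measurable_hermiteKernel u α) hqL
  have hcard : ((univ : Finset ι).offDiag.card : ℝ) ≤ (Fintype.card ι : ℝ) ^ 2 := by
    have h : (univ : Finset ι).offDiag.card ≤ Fintype.card ι ^ 2 := by
      rw [offDiag_card, Finset.card_univ, sq]
      exact Nat.sub_le _ _
    exact_mod_cast h
  have hqq := integral_hermiteKernel_sq_le hα0 hα1 hu
  set N : ℝ := (Fintype.card ι : ℝ) with hN_def
  set κ := hermiteCoeff α with hκ_def
  set P := Measure.pi fun _ : ι => stdGaussian E with hP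
  set S : (ι → E) → ℝ := fun y =>
    ∑ p ∈ (univ : Finset ι).offDiag, hermiteKernel u α (y p.1, y p.2) with hS
  have hSL : MemLp S 2 P := memLp_finsetSum _ fun p hp =>
    hqL.comp_measurePreserving (measurePreserving_pair (mem_offDiag.1 hp).2.2)
  have hmean' : ∫ y, S y ∂P ≤ N ^ 2 * κ ^ 2 / 32 := by
    rw [hmean]
    calc _ ≤ ((univ : Finset ι).offDiag.card : ℝ) * (κ ^ 2 / 32) := by gcongr
      _ ≤ N ^ 2 * (κ ^ 2 / 32) := by gcongr
      _ = _ := by ring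
  calc P.real {y | N ^ 2 * κ ^ 2 / 16 ≤ S y}
      ≤ P.real {y | N ^ 2 * κ ^ 2 / 32 ≤ |S y - ∫ z, S z ∂P|} := by
        refine measureReal_mono fun y hy => ?_
        simp only [Set.mem_ofPred_eq] at hy ⊢
        exact le_abs.2 (Or.inl (by linarith))
    _ ≤ Var[S; P] / (N ^ 2 * κ ^ 2 / 32) ^ 2 :=
        sq_mul_measureReal_abs_sub_ge_le_variance hSL (by positivity)
    _ ≤ 4 * N ^ 3 * (momentBound (2 * α) * ((momentBound 0 + momentBound 2) *
        (Module.finrank ℝ E : ℝ) ^ α)) / (N ^ 2 * κ ^ 2 / 32) ^ 2 := by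
        gcongr
        exact hvar.trans (by gcongr)
    _ = _ := by field_simp

omit [FiniteDimensional ℝ E] [MeasurableSpace E] [BorelSpace E] in
lemma sum_sum_hermite_mul_eq (u : E) (α : ℝ) (y : ι → E) :
    ∑ j, ∑ k, ((inner ℝ u (y j)) ^ 2 - 1) * |inner ℝ (y j) (y k)| ^ α *
        ((inner ℝ u (y k)) ^ 2 - 1) =
      ∑ j, ((inner ℝ u (y j)) ^ 2 - 1) ^ 2 * ‖y j‖ ^ (2 * α) +
        ∑ p ∈ (univ : Finset ι).offDiag, hermiteKernel u α (y p.1, y p.2) := by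
  have h : ∀ f : ι × ι → ℝ, ∑ j, ∑ k, f (j, k) =
      ∑ j, f (j, j) + ∑ p ∈ (univ : Finset ι).offDiag, f p := by
    intro f
    rw [← Fintype.sum_prod_type, ← univ_product_univ, ← Finset.diag_union_offDiag,
      Finset.sum_union (Finset.disjoint_diag_offDiag _), Finset.sum_diag]
  have hq := h fun p => hermiteKernel u α (y p.1, y p.2)
  refine Eq.trans (Finset.sum_congr rfl fun j _ => Finset.sum_congr rfl fun k _ => ?_)
    (hq.trans ?_)
  · rw [hermiteKernel]
    ring
  · congr 1
    refine Finset.sum_congr rfl fun j _ => ?_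
    rw [hermiteKernel, real_inner_self_eq_norm_sq, abs_of_nonneg (sq_nonneg _),
      Real.rpow_mul (norm_nonneg _), Real.rpow_two]
    ring

lemma measureReal_not_lt_sq_le {α : ℝ} (hα0 : 0 < α) (hα1 : α ≤ 1) {u : E} (hu : ‖u‖ = 1)
    (hι : 0 < Fintype.card ι)
    (hq : ∫ p, hermiteKernel u α p ∂((stdGaussian E).prod (stdGaussian E)) ≤
      hermiteCoeff α ^ 2 / 32) :
    (Measure.pi fun _ : ι => stdGaussian E).real
      {y | (∑ j, ((inner ℝ u (y j)) ^ 2 - 1) * |inner ℝ u (y j)| ^ α) ^ 2 ≤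
        ∑ j, ∑ k, ((inner ℝ u (y j)) ^ 2 - 1) * |inner ℝ (y j) (y k)| ^ α *
          ((inner ℝ u (y k)) ^ 2 - 1)} ≤
      failureConst α * (Module.finrank ℝ E : ℝ) ^ α / Fintype.card ι := by
  have hne : Nontrivial E := ⟨u, 0, fun h => by simp [h] at hu⟩
  have hn : 1 ≤ (Module.finrank ℝ E : ℝ) := by
    exact_mod_cast Module.finrank_pos (R := ℝ) (M := E)
  have hn1 : 1 ≤ (Module.finrank ℝ E : ℝ) ^ α := Real.one_le_rpow hn hα0.le
  have hN : 0 < (Fintype.card ι : ℝ) := by exact_mod_cast hι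
  have hκ := hermiteCoeff_pos hα0
  have hA := measureReal_linear_le (ι := ι) hα0 hu hι
  have hB := measureReal_diag_le hα0 hα1 hu hι
  have hC := measureReal_offDiag_le hα0 hα1 hu hι hq
  simp_rw [sum_sum_hermite_mul_eq]
  set A := {y : ι → E | ∑ j, ((inner ℝ u (y j)) ^ 2 - 1) * |inner ℝ u (y j)| ^ α ≤
    Fintype.card ι * hermiteCoeff α / 2} with hA_def
  set B := {y : ι → E | (Fintype.card ι : ℝ) ^ 2 * hermiteCoeff α ^ 2 / 16 ≤
    ∑ j, ((inner ℝ u (y j)) ^ 2 - 1) ^ 2 * ‖y j‖ ^ (2 * α)} with hB_def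
  set C := {y : ι → E | (Fintype.card ι : ℝ) ^ 2 * hermiteCoeff α ^ 2 / 16 ≤
    ∑ p ∈ (univ : Finset ι).offDiag, hermiteKernel u α (y p.1, y p.2)} with hC_def
  set P := Measure.pi fun _ : ι => stdGaussian E with hP
  have hV : 0 ≤ ∫ t : ℝ, ((t ^ 2 - 1) * |t| ^ α) ^ 2 ∂(gaussianReal 0 1) :=
    integral_nonneg fun _ => sq_nonneg _
  calc _ ≤ P.real (A ∪ B ∪ C) := by
        refine measureReal_mono fun y hy => ?_
        by_contra hcon
        simp only [Set.mem_union, not_or, hA_def, hB_def, hC_def, Set.mem_ofPred_eq, not_le]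
          at hcon hy
        have hpos : 0 < (Fintype.card ι : ℝ) * hermiteCoeff α := by positivity
        nlinarith [hcon.1.1, hcon.1.2, hcon.2]
    _ ≤ P.real A + P.real B + P.real C :=
        (measureReal_union_le _ _).trans (by gcongr; exact measureReal_union_le _ _)
    _ ≤ _ := add_le_add (add_le_add hA hB) hC
    _ ≤ 4 * (∫ t : ℝ, ((t ^ 2 - 1) * |t| ^ α) ^ 2 ∂(gaussianReal 0 1)) / hermiteCoeff α ^ 2 *
        (Module.finrank ℝ E : ℝ) ^ α / Fintype.card ι +
        16 / hermiteCoeff α ^ 2 * (momentBound 0 + momentBound 2) *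
        (Module.finrank ℝ E : ℝ) ^ α / Fintype.card ι +
        4 * momentBound (2 * α) * (32 / hermiteCoeff α ^ 2) ^ 2 *
        (momentBound 0 + momentBound 2) * (Module.finrank ℝ E : ℝ) ^ α / Fintype.card ι := by
        gcongr
        exact le_mul_of_one_le_right (by positivity) hn1
    _ = _ := by
        rw [failureConst]
        ring

end TestVector

section Wishart

variable {E : Type*} [NormedAddCommGroup E] [InnerProductSpace ℝ E]

/-- The tuples `y` for which the matrix with entries `|⟪y i, y j⟫ / c| ^ α` has a negative
direction. -/
def negativeForm (m : ℕ) (c α : ℝ) : Set (Fin m → E) :=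
  {y | ∃ v : Fin m → ℝ, ∑ i, ∑ j, v i * |inner ℝ (y i) (y j) / c| ^ α * v j < 0}

lemma isOpen_negativeForm (m : ℕ) (c : ℝ) {α : ℝ} (hα : 0 < α) :
    IsOpen (negativeForm m c α : Set (Fin m → E)) := by
  rw [negativeForm, Set.ofPred_exists]
  refine isOpen_iUnion fun v => isOpen_lt ?_ continuous_const
  refine continuous_finsetSum _ fun i _ => continuous_finsetSum _ fun j _ => ?_
  refine (continuous_const.mul (Continuous.rpow_const ?_ fun _ => Or.inr hα.le)).mul
    continuous_const
  fun_prop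

lemma mem_negativeForm {N : ℕ} {c α : ℝ} (hc : 0 < c) {y : Fin (N + 1) → E} (hy : y 0 ≠ 0)
    (h : ∑ j : Fin N, ∑ k : Fin N, ((inner ℝ (‖y 0‖⁻¹ • y 0) (y j.succ)) ^ 2 - 1) *
        |inner ℝ (y j.succ) (y k.succ)| ^ α * ((inner ℝ (‖y 0‖⁻¹ • y 0) (y k.succ)) ^ 2 - 1) <
      (∑ j : Fin N, ((inner ℝ (‖y 0‖⁻¹ • y 0) (y j.succ)) ^ 2 - 1) *
        |inner ℝ (‖y 0‖⁻¹ • y 0) (y j.succ)| ^ α) ^ 2) :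
    y ∈ negativeForm (N + 1) c α := by
  have hr : 0 < ‖y 0‖ := norm_pos_iff.2 hy
  set r := ‖y 0‖ with hr_def
  set u := r⁻¹ • y 0 with hu
  set w : Fin N → ℝ := fun j => (inner ℝ u (y j.succ)) ^ 2 - 1 with hw
  set S := ∑ j : Fin N, w j * |inner ℝ u (y j.succ)| ^ α with hS
  set Q := ∑ j : Fin N, ∑ k : Fin N, w j * |inner ℝ (y j.succ) (y k.succ)| ^ α * w k with hQ
  have hR : 0 < r ^ α := Real.rpow_pos_of_pos hr α
  have hd : 0 < (c⁻¹) ^ α := Real.rpow_pos_of_pos (inv_pos.2 hc) α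
  have habs : ∀ t : ℝ, |t / c| ^ α = (c⁻¹) ^ α * |t| ^ α := by
    intro t
    rw [abs_div, abs_of_pos hc, div_eq_mul_inv, Real.mul_rpow (abs_nonneg _) (inv_pos.2 hc).le,
      mul_comm]
  have h0 : ∀ x : E, |inner ℝ (y 0) x| ^ α = r ^ α * |inner ℝ u x| ^ α := by
    intro x
    have : y 0 = r • u := by rw [hu, smul_smul, mul_inv_cancel₀ hr.ne', one_smul]
    rw [this, real_inner_smul_left, abs_mul, abs_of_pos hr, Real.mul_rpow hr.le (abs_nonneg _)]
  have h00 : |inner ℝ (y 0) (y 0)| ^ α = r ^ α * r ^ α := by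
    rw [real_inner_self_eq_norm_sq, abs_of_nonneg (sq_nonneg _), sq, ← hr_def,
      Real.mul_rpow hr.le hr.le]
  refine ⟨Fin.cons (-(S / r ^ α)) w, ?_⟩
  have hcomm : ∀ j : Fin N, |inner ℝ (y j.succ) (y 0)| ^ α = r ^ α * |inner ℝ u (y j.succ)| ^ α :=
    fun j => by rw [real_inner_comm, h0]
  simp only [Fin.sum_univ_succ, Fin.cons_zero, Fin.cons_succ, habs, h00, hcomm, h0,
    Finset.sum_add_distrib]
  have e1 : ∑ j, -(S / r ^ α) * ((c⁻¹) ^ α * (r ^ α * |inner ℝ u (y j.succ)| ^ α)) * w j =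
      -((c⁻¹) ^ α * S * S) := by
    nth_rw 3 [hS]
    rw [Finset.mul_sum, ← Finset.sum_neg_distrib]
    refine Finset.sum_congr rfl fun j _ => ?_
    field_simp
  have e2 : ∑ j, w j * ((c⁻¹) ^ α * (r ^ α * |inner ℝ u (y j.succ)| ^ α)) * -(S / r ^ α) =
      -((c⁻¹) ^ α * S * S) := by
    rw [← e1]
    exact Finset.sum_congr rfl fun j _ => by ring
  have e3 : ∑ j, ∑ k, w j * ((c⁻¹) ^ α * |inner ℝ (y j.succ) (y k.succ)| ^ α) * w k =
      (c⁻¹) ^ α * Q := by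
    simp_rw [hQ, Finset.mul_sum]
    exact Finset.sum_congr rfl fun j _ => Finset.sum_congr rfl fun k _ => by ring
  have e0 : -(S / r ^ α) * ((c⁻¹) ^ α * (r ^ α * r ^ α)) * -(S / r ^ α) = (c⁻¹) ^ α * S * S := by
    field_simp
  rw [e0, e1, e2, e3]
  have := mul_pos hd (sub_pos.2 h)
  linarith

variable [FiniteDimensional ℝ E] [MeasurableSpace E] [BorelSpace E]

lemma stdGaussian_singleton_zero [Nontrivial E] : stdGaussian E {0} = 0 := by
  obtain ⟨u, hu⟩ := exists_norm_eq E zero_le_one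
  have hle : ({0} : Set E) ⊆ (fun x => inner ℝ u x) ⁻¹' {(0 : ℝ)} := by
    rintro x rfl
    simp
  refine measure_mono_null hle ?_
  rw [← Measure.map_apply (by fun_prop) (measurableSet_singleton _), map_inner_stdGaussian hu]
  have := nullSingletonClass_gaussianReal (μ := 0) (v := 1) one_ne_zero
  exact measure_singleton _

lemma measureReal_compl_negativeForm_le [Nontrivial E] {N : ℕ} (hN : 0 < N) {c α : ℝ} (hc : 0 < c)
    (hα0 : 0 < α) (hα1 : α ≤ 1)
    (hq : ∀ u : E, ‖u‖ = 1 →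
      ∫ p, hermiteKernel u α p ∂((stdGaussian E).prod (stdGaussian E)) ≤ hermiteCoeff α ^ 2 / 32) :
    (Measure.pi fun _ : Fin (N + 1) => stdGaussian E).real (negativeForm (N + 1) c α)ᶜ ≤
      failureConst α * (Module.finrank ℝ E : ℝ) ^ α / N := by
  set K := failureConst α * (Module.finrank ℝ E : ℝ) ^ α / N with hK
  have hmeas : MeasurableSet (negativeForm (N + 1) c α : Set (Fin (N + 1) → E))ᶜ :=
    (isOpen_negativeForm _ c hα0).measurableSet.compl
  have hfib : ∀ x : E, x ≠ 0 → (Measure.pi fun _ : Fin N => stdGaussian E).real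
      {y | (Fin.cons x y : Fin (N + 1) → E) ∈ (negativeForm (N + 1) c α)ᶜ} ≤ K := by
    intro x hx
    have hu : ‖‖x‖⁻¹ • x‖ = 1 := by
      rw [norm_smul, norm_inv, norm_norm, inv_mul_cancel₀ (norm_ne_zero_iff.2 hx)]
    have h := measureReal_not_lt_sq_le (ι := Fin N) hα0 hα1 hu (by simpa using hN) (hq _ hu)
    rw [Fintype.card_fin] at h
    refine le_trans (measureReal_mono fun y hy => ?_) h
    by_contra hcon
    refine hy (mem_negativeForm hc (by simpa using hx) ?_)
    simpa using hcon
  have hK0 : 0 ≤ K := by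
    obtain ⟨x, hx⟩ := exists_ne (0 : E)
    exact measureReal_nonneg.trans (hfib x hx)
  refine ENNReal.toReal_le_of_le_ofReal hK0 ?_
  have hmp := (measurePreserving_piFinSuccAbove (fun _ : Fin (N + 1) => stdGaussian E) 0).symm
  rw [← hmp.measure_preimage_equiv, Measure.prod_apply (hmp.measurable hmeas)]
  calc _ ≤ ∫⁻ _ : E, ENNReal.ofReal K ∂(stdGaussian E) := by
        refine lintegral_mono_ae ?_
        have hae : ∀ᵐ x ∂(stdGaussian E), x ≠ 0 := by
          rw [ae_iff]
          simpa using stdGaussian_singleton_zero (E := E)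
        filter_upwards [hae] with x hx
        rw [← ENNReal.ofReal_toReal (measure_ne_top _ _)]
        refine ENNReal.ofReal_le_ofReal (le_trans (le_of_eq ?_) (hfib x hx))
        congr 2
        ext y
        simp [MeasurableEquiv.piFinSuccAbove, Fin.insertNthEquiv]
    _ = ENNReal.ofReal K := by simp

end Wishart

section Asymptotics

lemma map_pi_curry {ι κ F : Type*} [Fintype ι] [Fintype κ] [MeasurableSpace F] (ν : Measure F)
    [IsProbabilityMeasure ν] :
    (Measure.pi fun _ : ι × κ => ν).map (fun x i j => x (i, j)) =
      Measure.pi fun _ : ι => Measure.pi fun _ : κ => ν := by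
  simp only [← Measure.infinitePi_eq_pi]
  exact Measure.infinitePi_map_curry fun (_ : ι) (_ : κ) => ν

lemma map_rows_pi_gaussianReal (m n : ℕ) :
    (Measure.pi fun _ : Fin m × Fin n => gaussianReal 0 1).map
        (fun x i => WithLp.toLp 2 fun j => x (i, j)) =
      Measure.pi fun _ : Fin m => stdGaussian (EuclideanSpace ℝ (Fin n)) := by
  have h : IsProbabilityMeasure
      ((Measure.pi fun _ : Fin n => gaussianReal 0 1).map (WithLp.toLp 2)) := by
    rw [map_pi_eq_stdGaussian]
    infer_instance
  simp_rw [← map_pi_eq_stdGaussian]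
  rw [← Measure.pi_map_pi fun _ => by fun_prop, ← map_pi_curry, Measure.map_map (by fun_prop)
    (by fun_prop)]
  rfl

lemma measureReal_wishart_eq {Ω : Type*} [MeasurableSpace Ω] {P : Measure Ω} {m n : ℕ}
    {X : Ω → Matrix (Fin m) (Fin n) ℝ} {α : ℝ} (hα : 0 < α)
    (hX : P.map (fun ω => fun p : Fin m × Fin n => X ω p.1 p.2) =
      Measure.pi fun _ : Fin m × Fin n => gaussianReal 0 1) :
    P.real {ω | ∃ v : Fin m → ℝ,
        (∑ i, ∑ j, v i * |(∑ k, X ω i k * X ω j k) / n| ^ α * v j) < 0} =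
      (Measure.pi fun _ : Fin m => stdGaussian (EuclideanSpace ℝ (Fin n))).real
        (negativeForm m n α) := by
  have hXm : AEMeasurable (fun ω => fun p : Fin m × Fin n => X ω p.1 p.2) P :=
    AEMeasurable.of_map_ne_zero (by rw [hX]; exact IsProbabilityMeasure.ne_zero _)
  have hrow : Measurable fun (x : Fin m × Fin n → ℝ) (i : Fin m) =>
      WithLp.toLp 2 fun j : Fin n => x (i, j) := by fun_prop
  have hmeas := (isOpen_negativeForm (E := EuclideanSpace ℝ (Fin n)) m n hα).measurableSet
  rw [← map_rows_pi_gaussianReal, ← hX, map_measureReal_apply hrow hmeas, Measure.real,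
    Measure.real, Measure.map_apply_of_aemeasurable hXm (hrow hmeas)]
  have hinner : ∀ ω (i j : Fin m), inner ℝ (WithLp.toLp 2 fun k => X ω i k)
      (WithLp.toLp 2 fun k => X ω j k) = ∑ k, X ω i k * X ω j k := fun ω i j => by
    simp [PiLp.inner_apply, mul_comm]
  simp only [negativeForm, Set.preimage_ofPred_eq, hinner]

lemma eventually_integral_hermiteKernel_le {α : ℝ} (hα0 : 0 < α) (hα1 : α ≤ 1) :
    ∀ᶠ n : ℕ in atTop, ∀ u : EuclideanSpace ℝ (Fin n), ‖u‖ = 1 →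
      ∫ p, hermiteKernel u α p ∂((stdGaussian (EuclideanSpace ℝ (Fin n))).prod
        (stdGaussian (EuclideanSpace ℝ (Fin n)))) ≤ hermiteCoeff α ^ 2 / 32 := by
  have hκ := hermiteCoeff_pos hα0
  set κ := hermiteCoeff α with hκ_def
  set M := ∫ t, |t| ^ (4 + 2 * α) ∂(gaussianReal 0 1) with hM
  have hM0 : 0 ≤ M := integral_nonneg fun t => by positivity
  set δ := κ / (64 * (M + 1)) with hδ_def
  have hδ : 0 < δ := by positivity
  have hlim : Tendsto (fun n : ℕ => κ * (δ * M + δ⁻¹ * ((n : ℕ) : ℝ)⁻¹)) atTop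
      (nhds (κ * (δ * M + δ⁻¹ * 0))) :=
    ((tendsto_inv_atTop_nhds_zero_nat.const_mul _).const_add _).const_mul _
  have hlt : κ * (δ * M + δ⁻¹ * 0) < κ ^ 2 / 32 := by
    have : δ * M ≤ κ / 64 := by
      rw [hδ_def, div_mul_eq_mul_div, div_le_div_iff₀ (by positivity) (by positivity)]
      nlinarith
    nlinarith
  filter_upwards [hlim.eventually_lt_const hlt] with n hn u hu
  have h := integral_hermiteKernel_le hα0 hα1 hu hδ
  rw [finrank_euclideanSpace_fin] at h
  exact h.trans hn.le

lemma tendsto_rpow_div_floor_rpow_sub_one {α s : ℝ} (hs : 0 < s) (hαs : α < s) :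
    Tendsto (fun n : ℕ => (n : ℝ) ^ α / ((⌊(n : ℝ) ^ s⌋₊ - 1 : ℕ) : ℝ)) atTop (nhds 0) := by
  have h1 : Tendsto (fun n : ℕ => 2 * (n : ℝ) ^ (-(s - α))) atTop (nhds (2 * 0)) :=
    ((tendsto_rpow_neg_atTop (sub_pos.2 hαs)).comp tendsto_natCast_atTop_atTop).const_mul 2
  rw [mul_zero] at h1
  refine squeeze_zero' (Eventually.of_forall fun n => by positivity) ?_ h1
  have h2 : ∀ᶠ n : ℕ in atTop, 4 ≤ (n : ℝ) ^ s :=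
    ((tendsto_rpow_atTop hs).comp tendsto_natCast_atTop_atTop).eventually_ge_atTop 4
  filter_upwards [h2, eventually_gt_atTop 0] with n hn hn0
  have hn0' : 0 < (n : ℝ) := by exact_mod_cast hn0
  have hfl : (n : ℝ) ^ s / 2 ≤ ((⌊(n : ℝ) ^ s⌋₊ - 1 : ℕ) : ℝ) := by
    have h3 := Nat.lt_floor_add_one ((n : ℝ) ^ s)
    have h4 : (⌊(n : ℝ) ^ s⌋₊ : ℝ) ≤ ((⌊(n : ℝ) ^ s⌋₊ - 1 : ℕ) : ℝ) + 1 := by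
      exact_mod_cast Nat.sub_le_iff_le_add.1 le_rfl
    linarith
  calc (n : ℝ) ^ α / ((⌊(n : ℝ) ^ s⌋₊ - 1 : ℕ) : ℝ) ≤ (n : ℝ) ^ α / ((n : ℝ) ^ s / 2) := by gcongr
    _ = 2 * (n : ℝ) ^ (-(s - α)) := by
        rw [neg_sub, Real.rpow_sub hn0']
        field_simp

end Asymptotics

/-- Fix `0 < s ≤ 1` and `0 < α < s`. Let `X_n` be `⌊n^s⌋ × n` random matrices
with i.i.d. standard Gaussian entries, `A_n = X_n X_nᵀ / n` and
`B_n = |A_n|^{∘α}` the entrywise `α`-th absolute power. Then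
`P(λ_min(B_n) < 0) → 1` as `n → ∞`; the event `λ_min(B_n) < 0` is expressed as
the existence of a vector with negative quadratic form. -/
theorem stmt_12 (s α : ℝ) (hs0 : 0 < s) (hs1 : s ≤ 1) (hα0 : 0 < α)
    (hαs : α < s)
    (Ω : Type) (mΩ : MeasurableSpace Ω) (μ : Measure Ω)
    (hμ : IsProbabilityMeasure μ)
    (X : (n : ℕ) → Ω → Matrix (Fin ⌊(n : ℝ) ^ s⌋₊) (Fin n) ℝ)
    (hX : ∀ n : ℕ, μ.map
        (fun ω => fun p : Fin ⌊(n : ℝ) ^ s⌋₊ × Fin n => X n ω p.1 p.2) =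
      Measure.pi (fun _ : Fin ⌊(n : ℝ) ^ s⌋₊ × Fin n => gaussianReal 0 1)) :
    Tendsto (fun n : ℕ =>
      (μ {ω | ∃ v : Fin ⌊(n : ℝ) ^ s⌋₊ → ℝ,
        (∑ i, ∑ j, v i * |(∑ k, X n ω i k * X n ω j k) / n| ^ α * v j)
          < 0}).toReal) atTop (nhds 1) := by
  have hα1 : α ≤ 1 := (hαs.trans_le hs1).le
  have hlow : Tendsto (fun n : ℕ =>
      1 - failureConst α * ((n : ℝ) ^ α / ((⌊(n : ℝ) ^ s⌋₊ - 1 : ℕ) : ℝ))) atTop (nhds 1) := by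
    simpa using ((tendsto_rpow_div_floor_rpow_sub_one hs0 hαs).const_mul
      (failureConst α)).const_sub 1
  refine tendsto_of_tendsto_of_tendsto_of_le_of_le' hlow tendsto_const_nhds ?_
    (Eventually.of_forall fun n => measureReal_le_one)
  have hm : ∀ᶠ n : ℕ in atTop, 2 ≤ ⌊(n : ℝ) ^ s⌋₊ :=
    (tendsto_nat_floor_atTop.comp
      ((tendsto_rpow_atTop hs0).comp tendsto_natCast_atTop_atTop)).eventually_ge_atTop 2
  filter_upwards [eventually_integral_hermiteKernel_le hα0 hα1, hm, eventually_gt_atTop 0]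
    with n hq hm hn
  have hmeas := measureReal_wishart_eq hα0 (hX n)
  rw [Measure.real] at hmeas
  rw [hmeas]
  generalize ⌊(n : ℝ) ^ s⌋₊ = m at hm ⊢
  obtain ⟨N, rfl⟩ : ∃ N, m = N + 1 := ⟨m - 1, by omega⟩
  have : Nonempty (Fin n) := ⟨⟨0, hn⟩⟩
  have h := measureReal_compl_negativeForm_le (E := EuclideanSpace ℝ (Fin n)) (N := N)
    (by omega) (c := n) (by exact_mod_cast hn) hα0 hα1 hq
  rw [probReal_compl_eq_one_sub (isOpen_negativeForm _ _ hα0).measurableSet,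
    finrank_euclideanSpace_fin, mul_div_assoc] at h
  rw [Nat.add_sub_cancel]
  linarith
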